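/- arXiv:math/0509513 — 2 statements merged into one kernel-verified Lean document; each statement's English description precedes it below -/
import Mathlib

section
/- Let N be a symmetric positive definite n×n real matrix of determinant 1, σ > 0, and f(t) = (2πσ²)^{-n/2} exp(-⟨t, N⁻¹t⟩/(2σ²)). Define the norm-like functional ⦀x⦀ = ⟨x, N⁻¹x⟩ on ℝ^n. Suppose B ⊆ ℤ^n has asymptotic density d with respect to ⦀·⦀, i.e. #{β ∈ B : ⦀β⦀ ≤ r} / #{β ∈ ℤ^n : ⦀β⦀ ≤ r} → d as r → ∞. Then T^{-n/2} Σ_{β ∈ B, |β_i| ≤ √T log T} f(β/√T) → d as T → ∞. -/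
open Filter Real Matrix
open MeasureTheory
open scoped Pointwise

open scoped MatrixOrder Matrix.Norms.L2Operator in
/-- A positive definite form of determinant one is the squared Euclidean norm in volume-preserving
coordinates. -/
theorem Matrix.PosDef.exists_continuousLinearEquiv_of_det_eq_one {ι : Type*} [Fintype ι]
    [DecidableEq ι] {P : Matrix ι ι ℝ} (hP : P.PosDef) (hdet : P.det = 1) :
    ∃ e : (ι → ℝ) ≃L[ℝ] EuclideanSpace ℝ ι, (∀ x, x ⬝ᵥ P *ᵥ x = ‖e x‖ ^ 2) ∧
      ∀ s, volume (e ⁻¹' s) = volume s := by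
  obtain ⟨C, rfl⟩ := CStarAlgebra.nonneg_iff_eq_star_mul_self.mp hP.posSemidef.nonneg
  have hC : C.det * C.det = 1 := by
    simpa [Matrix.det_mul, star_eq_conjTranspose, det_conjTranspose] using hdet
  have hC0 : C.det ≠ 0 := fun h => by simp [h] at hC
  let _ := C.invertibleOfIsUnitDet (isUnit_iff_ne_zero.2 hC0)
  refine ⟨(C.toLinearEquiv' inferInstance).toContinuousLinearEquiv.trans
    (PiLp.continuousLinearEquiv 2 ℝ fun _ : ι => ℝ).symm, fun x => ?_, fun s => ?_⟩
  · rw [EuclideanSpace.real_norm_sq_eq, ← mulVec_mulVec, dotProduct_mulVec, star_eq_conjTranspose,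
      conjTranspose_eq_transpose_of_trivial, vecMul_transpose]
    simp only [dotProduct, pow_two]
    rfl
  · rw [← (PiLp.volume_preserving_toLp ι).measure_preimage_emb
      (MeasurableEquiv.toLp 2 (ι → ℝ)).measurableEmbedding s]
    have := Measure.addHaar_preimage_linearMap (volume : Measure (ι → ℝ)) (f := Matrix.toLin' C)
      (by simpa using hC0) (WithLp.toLp 2 ⁻¹' s)
    have habs : |C.det| = 1 := by
      rcases mul_self_eq_one_iff.1 hC with h | h <;> simp [h]
    rw [LinearMap.det_toLin', abs_inv, habs, inv_one, ENNReal.ofReal_one, one_mul] at this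
    exact this

theorem ContinuousLinearEquiv.mem_Icc_of_norm_intCast_le {ι : Type*} [Fintype ι] [DecidableEq ι]
    {E : Type*} [NormedAddCommGroup E] [NormedSpace ℝ E] (e : (ι → ℝ) ≃L[ℝ] E) {β : ι → ℤ} {R : ℝ}
    (h : ‖(e.symm : E →L[ℝ] ι → ℝ)‖ * ‖e fun i => (β i : ℝ)‖ ≤ R) :
    β ∈ Finset.Icc (fun _ => -⌊R⌋ : ι → ℤ) (fun _ => ⌊R⌋) := by
  have hβ (i : ι) : |(β i : ℝ)| ≤ R := by
    refine (norm_le_pi_norm (fun i => (β i : ℝ)) i).trans (le_trans ?_ h)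
    simpa using (e.symm : E →L[ℝ] ι → ℝ).le_opNorm (e fun i => (β i : ℝ))
  refine Finset.mem_Icc.2 ⟨fun i => ?_, fun i => Int.le_floor.2 (abs_le.1 (hβ i)).2⟩
  rw [neg_le]
  exact Int.le_floor.2 (by push_cast; linarith [(abs_le.1 (hβ i)).1])

theorem ContinuousLinearEquiv.finite_intCast_norm_le {ι : Type*} [Fintype ι] {E : Type*}
    [NormedAddCommGroup E] [NormedSpace ℝ E] (e : (ι → ℝ) ≃L[ℝ] E) (r : ℝ) :
    {β : ι → ℤ | ‖e fun i => (β i : ℝ)‖ ≤ r}.Finite := by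
  classical
  exact (Finset.finite_toSet _).subset fun β hβ =>
    e.mem_Icc_of_norm_intCast_le (mul_le_mul_of_nonneg_left hβ (norm_nonneg _))

/-- The lattice points of norm at most `r` are asymptotically `volume (unit ball) * r ^ dim`. -/
theorem ContinuousLinearEquiv.tendsto_ncard_intCast_norm_le {ι : Type*} [Fintype ι] {E : Type*}
    [NormedAddCommGroup E] [NormedSpace ℝ E] (e : (ι → ℝ) ≃L[ℝ] E) :
    Tendsto (fun r : ℝ => ({β : ι → ℤ | ‖e fun i => (β i : ℝ)‖ ≤ r}.ncard : ℝ) /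
      r ^ Fintype.card ι) atTop
      (nhds (volume.real (e ⁻¹' Metric.closedBall 0 1))) := by
  classical
  have hconv : Convex ℝ (e ⁻¹' Metric.closedBall 0 1) :=
    (convex_closedBall 0 1).linear_preimage (e : (ι → ℝ) →ₗ[ℝ] E)
  refine (tendsto_card_div_pow_atTop_volume' (e ⁻¹' Metric.closedBall 0 1) ?_
    (Metric.isClosed_closedBall.preimage e.continuous).measurableSet
    (hconv.addHaar_frontier volume) ?_).congr' ?_
  · exact e.antilipschitz.isBounded_preimage Metric.isBounded_closedBall
  · rintro x y hx hxy _ ⟨a, ha, rfl⟩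
    have hy := hx.trans_le hxy
    rw [Set.mem_smul_set_iff_inv_smul_mem₀ hy.ne', smul_smul]
    exact hconv.smul_mem_of_zero_mem (by simp) ha
      ⟨by positivity, by rwa [inv_mul_le_iff₀ hy, mul_one]⟩
  · filter_upwards [eventually_gt_atTop 0] with r hr
    congr 2
    rw [← Nat.card_coe_set_eq]
    refine (Nat.card_congr (Equiv.ofBijective
      (fun β : {β : ι → ℤ | ‖e fun i => (β i : ℝ)‖ ≤ r} =>
        (⟨r⁻¹ • fun i => (β.1 i : ℝ), ?_, ?_⟩ : ↥(e ⁻¹' Metric.closedBall 0 1 ∩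
          r⁻¹ • (Submodule.span ℤ (Set.range (Pi.basisFun ℝ ι)) : Set (ι → ℝ)))))
      ⟨?_, ?_⟩)).symm
    · have := β.2
      simp only [Set.mem_ofPred_eq] at this
      simp only [Set.mem_preimage, map_smul, mem_closedBall_zero_iff, norm_smul, norm_inv,
        norm_of_nonneg hr.le]
      rwa [inv_mul_le_iff₀ hr, mul_one]
    · exact Set.smul_mem_smul_set (((Pi.basisFun ℝ ι).mem_span_iff_repr_mem ℤ _).2 fun i => by simp)
    · intro β γ h
      have h' := smul_right_injective _ (inv_ne_zero hr.ne') (Subtype.ext_iff.1 h)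
      ext i
      exact_mod_cast congrFun h' i
    · rintro ⟨x, hx, y, hy, rfl⟩
      have hy' := ((Pi.basisFun ℝ ι).mem_span_iff_repr_mem ℤ _).1 hy
      choose β hβ using hy'
      have hβy : (fun i => (β i : ℝ)) = y := funext fun i => by simpa using hβ i
      refine ⟨⟨β, ?_⟩, Subtype.ext (by simp only [hβy])⟩
      simp only [Set.mem_preimage, map_smul, mem_closedBall_zero_iff, norm_smul, norm_inv,
        norm_of_nonneg hr.le] at hx
      rw [inv_mul_le_iff₀ hr, mul_one] at hx
      simpa only [Set.mem_ofPred_eq, hβy] using hx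
/-- Laplace-transform Abelian theorem for counting functions, with a truncated sum. -/
theorem tendsto_sum_exp_neg_div_rpow {ι : Type*} {q : ι → ℝ} (hq : ∀ x, 0 ≤ q x)
    (B : Set ι) (hfin : ∀ r, {x | x ∈ B ∧ q x ≤ r}.Finite) {κ L : ℝ} (hκ : 0 ≤ κ)
    (hL : Tendsto (fun r : ℝ => ({x | x ∈ B ∧ q x ≤ r}.ncard : ℝ) / r ^ κ) atTop (nhds L))
    (F : ℝ → Finset ι) (hF : ∀ u, ∀ᶠ T in atTop, ∀ x, q x ≤ u * T → x ∈ F T) :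
    Tendsto (fun T : ℝ => (∑ x ∈ F T, B.indicator (fun x => exp (-(q x / T))) x) / T ^ κ)
      atTop (nhds (L * Real.Gamma (κ + 1))) := by
  classical
  set A : ℝ → Set ι := fun r => {x | x ∈ B ∧ q x ≤ r} with hA
  have hmono : ∀ {r s : ℝ}, r ≤ s → (A r).ncard ≤ (A s).ncard := fun h =>
    Set.ncard_le_ncard (fun x hx => ⟨hx.1, hx.2.trans h⟩) (hfin _)
  obtain ⟨C, hC0, hC⟩ : ∃ C : ℝ, 0 ≤ C ∧ ∀ r, 0 ≤ r → ((A r).ncard : ℝ) ≤ C * (1 + r ^ κ) := by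
    obtain ⟨R, hR⟩ := eventually_atTop.1 ((hL.eventually_lt_const (lt_add_one L)).and
      (eventually_gt_atTop 0))
    have hR0 : 0 < R := (hR R le_rfl).2
    have hL1 : 0 ≤ L + 1 := (div_nonneg (Nat.cast_nonneg _) (rpow_nonneg hR0.le _)).trans
      (hR R le_rfl).1.le
    refine ⟨L + 1 + (A R).ncard, by positivity, fun r hr => ?_⟩
    have hrκ : 0 ≤ r ^ κ := rpow_nonneg hr _
    have hAR : (0 : ℝ) ≤ (A R).ncard := Nat.cast_nonneg _
    rcases le_total R r with h | h
    · have := (div_lt_iff₀ (rpow_pos_of_pos (hR r h).2 κ)).1 (hR r h).1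
      nlinarith [mul_nonneg hAR hrκ]
    · have : ((A r).ncard : ℝ) ≤ (A R).ncard := by exact_mod_cast hmono h
      nlinarith [mul_nonneg hAR hrκ, mul_nonneg hL1 hrκ]
  set G : ℝ → ℝ → ℝ := fun T u =>
    ∑ x ∈ (F T).filter (· ∈ B), (Set.Ici (q x / T)).indicator (fun u => exp (-u)) u with hG
  have hGcard : ∀ {T u : ℝ}, 0 < T →
      G T u = (((F T).filter fun x => x ∈ B ∧ q x ≤ u * T).card : ℝ) * exp (-u) := by
    intro T u hT
    simp only [hG, Set.indicator_apply, Set.mem_Ici, div_le_iff₀ hT]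
    rw [← Finset.sum_filter, Finset.sum_const, nsmul_eq_mul, Finset.filter_filter]
  have hGle : ∀ {T u : ℝ}, 0 < T → G T u ≤ ((A (u * T)).ncard : ℝ) * exp (-u) := by
    intro T u hT
    rw [hGcard hT]
    gcongr
    rw [← Set.ncard_coe_finset]
    exact Set.ncard_le_ncard (fun x hx => (Finset.mem_filter.1 hx).2) (hfin _)
  have hGeq : ∀ u, ∀ᶠ T in atTop, G T u = ((A (u * T)).ncard : ℝ) * exp (-u) := by
    intro u
    filter_upwards [hF u, eventually_gt_atTop 0] with T h hT
    rw [hGcard hT, ← Set.ncard_coe_finset]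
    congr 3
    ext x
    simp only [hA, Finset.coe_filter, Set.mem_ofPred_eq, and_iff_right_iff_imp]
    exact fun hx => h x hx.2
  have hint : ∀ {a : ℝ}, 0 ≤ a →
      ∫ u in Set.Ioi (0 : ℝ), (Set.Ici a).indicator (fun u => exp (-u)) u = exp (-a) := by
    intro a ha
    rw [← integral_Ici_eq_integral_Ioi, setIntegral_indicator measurableSet_Ici,
      Set.Ici_inter_Ici, sup_of_le_right ha, integral_Ici_eq_integral_Ioi, integral_exp_neg_Ioi]
  have hsum : ∀ᶠ T : ℝ in atTop, ∫ u in Set.Ioi (0 : ℝ), G T u / T ^ κ =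
      (∑ x ∈ F T, B.indicator (fun x => exp (-(q x / T))) x) / T ^ κ := by
    filter_upwards [eventually_gt_atTop 0] with T hT
    rw [integral_div, integral_finsetSum]
    · simp only [Set.indicator_apply B]
      rw [← Finset.sum_filter]
      congr 1
      exact Finset.sum_congr rfl fun x _ => hint (div_nonneg (hq x) hT.le)
    · exact fun x _ => (integrableOn_exp_neg_Ioi 0).indicator measurableSet_Ici
  refine Tendsto.congr' hsum ?_
  have hgi : IntegrableOn (fun u : ℝ => exp (-u) * u ^ κ) (Set.Ioi 0) := by
    simpa using GammaIntegral_convergent (s := κ + 1) (by linarith)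
  have hlim : L * Real.Gamma (κ + 1) = ∫ u in Set.Ioi (0 : ℝ), L * (exp (-u) * u ^ κ) := by
    rw [Gamma_eq_integral (by linarith), integral_const_mul, add_sub_cancel_right]
  rw [hlim]
  refine tendsto_integral_filter_of_dominated_convergence
    (fun u => C * (exp (-u) + exp (-u) * u ^ κ)) ?_ ?_ ?_ ?_
  · refine Eventually.of_forall fun T => Measurable.aestronglyMeasurable ?_
    exact (Finset.measurable_sum _ fun x _ =>
      (by fun_prop : Measurable fun u : ℝ => exp (-u)).indicator measurableSet_Ici).div_const _
  · filter_upwards [eventually_ge_atTop 1] with T hT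
    refine (ae_restrict_mem measurableSet_Ioi).mono fun u hu => ?_
    have hu0 : (0 : ℝ) < u := hu
    have hT0 : 0 < T := by linarith
    have hTκ : 1 ≤ T ^ κ := one_le_rpow hT hκ
    have hG0 : 0 ≤ G T u := by rw [hGcard hT0]; positivity
    rw [norm_of_nonneg (by positivity), div_le_iff₀ (by positivity)]
    refine (hGle hT0).trans ?_
    calc ((A (u * T)).ncard : ℝ) * exp (-u) ≤ C * (1 + (u * T) ^ κ) * exp (-u) := by
          gcongr; exact hC _ (by positivity)
      _ ≤ C * (T ^ κ + u ^ κ * T ^ κ) * exp (-u) := by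
          rw [mul_rpow hu0.le hT0.le]; gcongr
      _ = _ := by ring
  · exact ((integrableOn_exp_neg_Ioi 0).add hgi).const_mul C
  · refine (ae_restrict_mem measurableSet_Ioi).mono fun u hu => ?_
    have hu0 : (0 : ℝ) < u := hu
    have h := ((hL.comp (tendsto_id.const_mul_atTop hu0)).mul_const (u ^ κ * exp (-u)))
    rw [show L * (exp (-u) * u ^ κ) = L * (u ^ κ * exp (-u)) by ring]
    refine h.congr' ?_
    filter_upwards [hGeq u, eventually_gt_atTop 0] with T h hT
    have h1 := (rpow_pos_of_pos hT κ).ne'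
    have h2 := (rpow_pos_of_pos hu0 κ).ne'
    rw [h]
    simp only [Function.comp, id, mul_rpow hu0.le hT.le]
    field_simp
    simp only [hA]

theorem stmt_5 (n : ℕ) (hn : 0 < n) (σ : ℝ) (hσ : 0 < σ)
    (N : Matrix (Fin n) (Fin n) ℝ) (hsym : N.IsSymm) (hpd : N.PosDef) (hdet : N.det = 1)
    (B : Set (Fin n → ℤ)) (d : ℝ)
    (hB : Tendsto (fun r : ℝ =>
      (Nat.card {β : Fin n → ℤ | β ∈ B ∧
          (fun i => (β i : ℝ)) ⬝ᵥ N⁻¹.mulVec (fun i => (β i : ℝ)) ≤ r} : ℝ) /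
      (Nat.card {β : Fin n → ℤ |
          (fun i => (β i : ℝ)) ⬝ᵥ N⁻¹.mulVec (fun i => (β i : ℝ)) ≤ r} : ℝ))
      atTop (nhds d)) :
    Tendsto (fun T : ℝ =>
      (∑ β ∈ Finset.Icc (fun _ => -⌊Real.sqrt T * Real.log T⌋ : Fin n → ℤ)
          (fun _ => ⌊Real.sqrt T * Real.log T⌋),
        Set.indicator B (fun β : Fin n → ℤ =>
          (2 * Real.pi * σ ^ 2) ^ (-(n : ℝ) / 2) *
            Real.exp (-((fun i => (β i : ℝ) / Real.sqrt T) ⬝ᵥ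
              N⁻¹.mulVec (fun i => (β i : ℝ) / Real.sqrt T)) / (2 * σ ^ 2))) β)
        / T ^ ((n : ℝ) / 2))
      atTop (nhds d) := by
  have : Nonempty (Fin n) := ⟨⟨0, hn⟩⟩
  obtain ⟨e, he, hvol⟩ := hpd.inv.exists_continuousLinearEquiv_of_det_eq_one
    (by rw [det_nonsing_inv, hdet, Ring.inverse_one])
  have hV : volume.real (e ⁻¹' Metric.closedBall 0 1) =
      π ^ ((n : ℝ) / 2) / Real.Gamma ((n : ℝ) / 2 + 1) := by
    have hΓ : 0 < Real.Gamma ((n : ℝ) / 2 + 1) := Gamma_pos_of_pos (by positivity)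
    rw [measureReal_def, hvol, EuclideanSpace.volume_closedBall, ENNReal.ofReal_one, one_pow,
      one_mul, Fintype.card_fin, ENNReal.toReal_ofReal (by positivity), sqrt_eq_rpow,
      ← rpow_mul_natCast pi_pos.le]
    congr 2
    ring
  simp only [he] at hB ⊢
  set c : ℝ := 2 * σ ^ 2 with hc
  have hc0 : 0 < c := by positivity
  have hle : ∀ {r : ℝ}, 0 ≤ r → ∀ β : Fin n → ℤ,
      ‖e fun i => (β i : ℝ)‖ ^ 2 ≤ r ↔ ‖e fun i => (β i : ℝ)‖ ≤ √r :=
    fun hr β => (le_sqrt (norm_nonneg _) hr).symm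
  have hfin : ∀ r : ℝ, {β : Fin n → ℤ | ‖e fun i => (β i : ℝ)‖ ^ 2 ≤ r}.Finite := by
    refine fun r => (e.finite_intCast_norm_le √(max r 0)).subset fun β hβ => ?_
    exact (hle (le_max_right r 0) β).1 (le_trans hβ (le_max_left r 0))
  have hcount : Tendsto (fun r : ℝ =>
      ({β : Fin n → ℤ | ‖e fun i => (β i : ℝ)‖ ^ 2 ≤ r}.ncard : ℝ) / r ^ ((n : ℝ) / 2)) atTop
      (nhds (π ^ ((n : ℝ) / 2) / Real.Gamma ((n : ℝ) / 2 + 1))) := by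
    rw [← hV]
    refine (e.tendsto_ncard_intCast_norm_le.comp tendsto_sqrt_atTop).congr' ?_
    filter_upwards [eventually_ge_atTop 0] with r hr
    simp only [Function.comp, hle hr, Fintype.card_fin]
    rw [sqrt_eq_rpow, ← rpow_mul_natCast hr]
    congr 2
    ring
  have hcountB : Tendsto (fun r : ℝ =>
      ({β : Fin n → ℤ | β ∈ B ∧ ‖e fun i => (β i : ℝ)‖ ^ 2 ≤ r}.ncard : ℝ) / r ^ ((n : ℝ) / 2))
      atTop (nhds (d * (π ^ ((n : ℝ) / 2) / Real.Gamma ((n : ℝ) / 2 + 1)))) := by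
    refine (hB.mul hcount).congr' ?_
    filter_upwards [eventually_ge_atTop 0] with r hr
    simp only [Nat.card_coe_set_eq]
    refine div_mul_div_cancel₀ (Nat.cast_ne_zero.2 ((Set.ncard_pos (hfin r)).2 ⟨0, ?_⟩).ne')
    have h0 : (fun i : Fin n => ((0 : Fin n → ℤ) i : ℝ)) = 0 := by ext; simp
    change ‖e fun i => ((0 : Fin n → ℤ) i : ℝ)‖ ^ 2 ≤ r
    simpa only [h0, map_zero, norm_zero, ne_eq, OfNat.ofNat_ne_zero, not_false_eq_true, zero_pow]
      using hr
  have hcountB' : Tendsto (fun r : ℝ =>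
      ({β : Fin n → ℤ | β ∈ B ∧ ‖e fun i => (β i : ℝ)‖ ^ 2 / c ≤ r}.ncard : ℝ) /
        r ^ ((n : ℝ) / 2)) atTop
      (nhds (d * (π ^ ((n : ℝ) / 2) / Real.Gamma ((n : ℝ) / 2 + 1)) * c ^ ((n : ℝ) / 2))) := by
    refine ((hcountB.comp (tendsto_id.const_mul_atTop hc0)).mul_const _).congr' ?_
    filter_upwards [eventually_gt_atTop 0] with r hr
    have := (rpow_pos_of_pos hc0 ((n : ℝ) / 2)).ne'
    simp only [Function.comp, id, div_le_iff₀' hc0, mul_rpow hc0.le hr.le]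
    field_simp
  have key := tendsto_sum_exp_neg_div_rpow (κ := (n : ℝ) / 2)
    (q := fun β : Fin n → ℤ => ‖e fun i => (β i : ℝ)‖ ^ 2 / c) (fun β => by positivity) B
    (fun r => (hfin (c * r)).subset fun β hβ => (div_le_iff₀' hc0).1 hβ.2) (by positivity) hcountB'
    (fun T => Finset.Icc (fun _ => -⌊√T * Real.log T⌋) (fun _ => ⌊√T * Real.log T⌋)) ?_
  · have hlim : (2 * π * σ ^ 2) ^ (-(n : ℝ) / 2) *
        (d * (π ^ ((n : ℝ) / 2) / Real.Gamma ((n : ℝ) / 2 + 1)) * c ^ ((n : ℝ) / 2) *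
          Real.Gamma ((n : ℝ) / 2 + 1)) = d := by
      have hΓ : Real.Gamma ((n : ℝ) / 2 + 1) ≠ 0 := (Gamma_pos_of_pos (by positivity)).ne'
      have h1 := (rpow_pos_of_pos hc0 ((n : ℝ) / 2)).ne'
      have h2 := (rpow_pos_of_pos pi_pos ((n : ℝ) / 2)).ne'
      rw [show 2 * π * σ ^ 2 = π * c by rw [hc]; ring, neg_div, rpow_neg (by positivity),
        mul_rpow pi_pos.le hc0.le]
      field_simp
    rw [← hlim]
    refine (key.const_mul ((2 * π * σ ^ 2) ^ (-(n : ℝ) / 2))).congr' ?_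
    filter_upwards [eventually_gt_atTop 0] with T hT
    rw [← mul_div_assoc, Finset.mul_sum]
    congr 1
    refine Finset.sum_congr rfl fun β _ => ?_
    by_cases hβ : β ∈ B
    · have hscale : (fun i => (β i : ℝ) / √T) = (√T)⁻¹ • fun i => (β i : ℝ) := by
        ext i; simp [div_eq_inv_mul]
      rw [Set.indicator_of_mem hβ, Set.indicator_of_mem hβ, hscale, map_smul, norm_smul, mul_pow,
        norm_inv, norm_of_nonneg (sqrt_nonneg T), inv_pow, sq_sqrt hT.le]
      congr 2
      field_simp
    · simp [hβ]
  · intro u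
    set K : ℝ := ‖(e.symm : EuclideanSpace ℝ (Fin n) →L[ℝ] Fin n → ℝ)‖
    filter_upwards [tendsto_log_atTop.eventually_ge_atTop (K * √(c * u)),
      eventually_gt_atTop 0] with T hlog hT β hβ
    have hnorm : ‖e fun i => (β i : ℝ)‖ ≤ √(c * u) * √T := by
      rw [← sqrt_mul' _ hT.le]
      refine le_sqrt_of_sq_le ?_
      rwa [div_le_iff₀' hc0, ← mul_assoc] at hβ
    refine e.mem_Icc_of_norm_intCast_le ?_
    calc K * ‖e fun i => (β i : ℝ)‖ ≤ K * (√(c * u) * √T) := by gcongr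
      _ = √T * (K * √(c * u)) := by ring
      _ ≤ √T * Real.log T := by gcongr
end

section
/- Let Π(m) denote the number of conjugacy classes of the free group on k ≥ 2 generators whose cyclically reduced length is at most m, and let q = 2k-1. Then Π(m) ~ (q/(q-1)) · q^m/m as m → ∞. -/
open Filter

/-- The cyclically reduced length of a conjugacy class of the free group: the minimal
word length of a representative. -/
noncomputable def classLength {k : ℕ} (c : ConjClasses (FreeGroup (Fin k))) : ℕ :=
  sInf {n : ℕ | ∃ γ : FreeGroup (Fin k), ConjClasses.mk γ = c ∧ γ.toWord.length = n}

namespace FreeGroup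

section Rotation

variable {α : Type*}

theorem isCyclicallyReduced_cons_iff {a : α × Bool} {M : List (α × Bool)} :
    IsCyclicallyReduced (a :: M) ↔ IsReduced M ∧ (∀ b ∈ M.head?, a.1 = b.1 → a.2 = b.2) ∧
      ∀ b ∈ M.getLast?, b.1 = a.1 → b.2 = a.2 := by
  rw [IsCyclicallyReduced, IsReduced, List.isChain_cons]
  rcases M.eq_nil_or_concat with rfl | ⟨M, b, rfl⟩
  · simp
  · simp [IsReduced, List.getLast?_cons]
    tauto

theorem isCyclicallyReduced_concat_iff {a : α × Bool} {M : List (α × Bool)} :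
    IsCyclicallyReduced (M ++ [a]) ↔ IsCyclicallyReduced (a :: M) := by
  rw [isCyclicallyReduced_cons_iff, IsCyclicallyReduced, IsReduced, List.isChain_append]
  cases M with
  | nil => simp
  | cons b M =>
    rw [List.getLast?_concat]
    simp only [IsReduced, List.isChain_singleton, List.head?_cons, Option.mem_def,
      Option.some.injEq, forall_eq', true_and, List.cons_append]
    tauto

theorem IsCyclicallyReduced.rotate {L : List (α × Bool)} (h : IsCyclicallyReduced L) (n : ℕ) :
    IsCyclicallyReduced (L.rotate n) := by
  induction n with
  | zero => simpa
  | succ n ih =>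
    rw [← List.rotate_rotate]
    cases hL : L.rotate n with
    | nil => simp
    | cons a M => simpa [isCyclicallyReduced_concat_iff, hL] using ih

theorem isConj_mk_rotate (L : List (α × Bool)) (n : ℕ) :
    IsConj (mk L) (mk (L.rotate n)) := by
  induction n with
  | zero => rw [List.rotate_zero]
  | succ n ih =>
    refine ih.trans ?_
    rw [← List.rotate_rotate]
    cases L.rotate n with
    | nil => exact IsConj.refl _
    | cons a M =>
      rw [isConj_iff]
      refine ⟨(mk [a])⁻¹, ?_⟩
      have h1 : mk (a :: M) = mk [a] * mk M := by simp
      have h2 : mk ((a :: M).rotate 1) = mk M * mk [a] := by simp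
      rw [h1, h2]
      group

variable [DecidableEq α]

theorem IsCyclicallyReduced.reduceCyclically_eq {L : List (α × Bool)}
    (h : IsCyclicallyReduced L) : reduceCyclically L = L := by
  induction L using List.bidirectionalRec with
  | nil => simp
  | singleton => simp
  | cons_append a l b _ =>
    have h2 := (isCyclicallyReduced_cons_append_iff.1 h).2
    rw [reduceCyclically.cons_append, if_neg]
    · simp
    · rintro ⟨h3, h4⟩
      simp [h2 h3] at h4

theorem length_reduceCyclically_le (L : List (α × Bool)) :
    (reduceCyclically L).length ≤ L.length := by
  conv_rhs => rw [← reduceCyclically.conj_conjugator_reduceCyclically L]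
  simp only [List.length_append]
  omega

theorem head?_not_inv_or_eq_cons (a : α × Bool) (M : List (α × Bool)) :
    (∀ b ∈ M.head?, a.1 = b.1 → a.2 = b.2) ∨ ∃ M₁, M = (a.1, !a.2) :: M₁ := by
  cases M with
  | nil => simp
  | cons b M =>
    rcases a with ⟨a, s⟩
    rcases b with ⟨b, t⟩
    cases s <;> cases t <;> simp <;> tauto

theorem getLast?_not_inv_or_eq_concat (a : α × Bool) (M : List (α × Bool)) :
    (∀ b ∈ M.getLast?, b.1 = a.1 → b.2 = a.2) ∨ ∃ M₁, M = M₁ ++ [(a.1, !a.2)] := by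
  rcases M.eq_nil_or_concat with rfl | ⟨M, b, rfl⟩
  · simp
  · rcases a with ⟨a, s⟩
    rcases b with ⟨b, t⟩
    cases s <;> cases t <;> simp <;> tauto

theorem reduceCyclically_reduce_cons_isRotated {a : α × Bool} {M : List (α × Bool)}
    (hM : IsReduced M) :
    reduceCyclically (reduce (a :: M)) ~r reduceCyclically (reduce (M ++ [a])) := by
  have red_cons : ∀ M₁, IsReduced M₁ → reduce (a :: (a.1, !a.2) :: M₁) = M₁ := fun M₁ h ↦ by
    rw [reduce.Step.eq (L₂ := M₁) Red.Step.cons_not]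
    exact h.reduce_eq
  have red_concat : ∀ M₁, IsReduced M₁ → reduce (M₁ ++ [(a.1, !a.2)] ++ [a]) = M₁ := fun M₁ h ↦ by
    rw [reduce.Step.eq (L₂ := M₁)
      (by simpa using Red.Step.not (L₁ := M₁) (L₂ := []) (b := !a.2) (x := a.1))]
    exact h.reduce_eq
  rcases head?_not_inv_or_eq_cons a M with h1 | ⟨M₁, h1⟩ <;>
    rcases getLast?_not_inv_or_eq_concat a M with h2 | ⟨M₂, h2⟩
  · have h := isCyclicallyReduced_cons_iff.2 ⟨hM, h1, h2⟩
    have h' := isCyclicallyReduced_concat_iff.2 h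
    rw [h.isReduced.reduce_eq, h'.isReduced.reduce_eq, h.reduceCyclically_eq,
      h'.reduceCyclically_eq]
    exact ⟨1, by simp⟩
  · have h3 : IsReduced (a :: M) := List.isChain_cons.2 ⟨h1, hM⟩
    rw [h3.reduce_eq, h2, red_concat _ (List.isChain_append.1 (h2 ▸ hM)).1,
      reduceCyclically.cons_append, if_pos (by simp)]
  · have h3 : IsReduced (M ++ [a]) := List.isChain_append.2 ⟨hM, by simp, by simpa using h2⟩
    rw [h3.reduce_eq, h1, red_cons _ (List.isChain_cons.1 (h1 ▸ hM)).2, List.cons_append,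
      reduceCyclically.cons_append, if_pos (by simp)]
  · have hr1 : IsReduced M₁ := (List.isChain_cons.1 (h1 ▸ hM)).2
    have hr2 : IsReduced M₂ := (List.isChain_append.1 (h2 ▸ hM)).1
    have e1 := red_cons _ hr1
    have e2 := red_concat _ hr2
    rw [← h1] at e1
    rw [← h2] at e2
    rw [e1, e2]
    cases M₂ with
    | nil =>
      obtain rfl : M₁ = [] := by simpa [h2, eq_comm] using h1
      rfl
    | cons b M' =>
      obtain ⟨rfl, rfl⟩ : b = (a.1, !a.2) ∧ M' ++ [(a.1, !a.2)] = M₁ := by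
        simpa [h2] using h1
      have h : IsCyclicallyReduced ((a.1, !a.2) :: M') := by
        refine isCyclicallyReduced_cons_iff.2 ⟨(List.isChain_cons.1 hr2).2,
          (List.isChain_cons.1 hr2).1, ?_⟩
        simpa using (List.isChain_append.1 hr1).2.2
      have h' := isCyclicallyReduced_concat_iff.2 h
      rw [h.reduceCyclically_eq, h'.reduceCyclically_eq]
      exact List.IsRotated.symm ⟨1, by simp⟩

theorem reduceCyclically_toWord_mul_comm (x y : FreeGroup α) :
    reduceCyclically (x * y).toWord ~r reduceCyclically (y * x).toWord := by
  rw [← mk_toWord (x := x)]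
  generalize x.toWord = L
  induction L generalizing y with
  | nil =>
    rw [← one_eq_mk, one_mul, mul_one]
  | cons a L ih =>
    have h : mk (a :: L) = mk [a] * mk L := by simp
    have key : ∀ z : FreeGroup α,
        reduceCyclically (mk [a] * z).toWord ~r reduceCyclically (z * mk [a]).toWord := fun z ↦ by
      have := reduceCyclically_reduce_cons_isRotated (a := a) (isReduced_toWord (x := z))
      rwa [← toWord_mk, ← toWord_mk, ← List.singleton_append, ← mul_mk, ← mul_mk, mk_toWord] at this
    rw [h, mul_assoc, ← mul_assoc y]
    refine (key _).trans ?_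
    rw [mul_assoc]
    exact ih _

theorem _root_.IsConj.reduceCyclically_isRotated {x y : FreeGroup α} (h : IsConj x y) :
    reduceCyclically x.toWord ~r reduceCyclically y.toWord := by
  obtain ⟨c, rfl⟩ := isConj_iff.1 h
  have := reduceCyclically_toWord_mul_comm (c⁻¹) (c * x)
  rwa [inv_mul_cancel_left] at this

theorem IsCyclicallyReduced.isRotated_of_isConj {L L' : List (α × Bool)}
    (h : IsCyclicallyReduced L) (h' : IsCyclicallyReduced L') (hc : IsConj (mk L) (mk L')) :
    L ~r L' := by
  have := hc.reduceCyclically_isRotated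
  rwa [toWord_mk, toWord_mk, h.isReduced.reduce_eq, h'.isReduced.reduce_eq,
    h.reduceCyclically_eq, h'.reduceCyclically_eq] at this

theorem exists_isCyclicallyReduced_isConj (x : FreeGroup α) :
    ∃ L, IsCyclicallyReduced L ∧ IsConj x (mk L) := by
  refine ⟨reduceCyclically x.toWord,
    reduceCyclically.isCyclicallyReduced isReduced_toWord, isConj_iff.2
      ⟨(mk (reduceCyclically.conjugator x.toWord))⁻¹, ?_⟩⟩
  have := congr_arg mk (reduceCyclically.conj_conjugator_reduceCyclically x.toWord)
  rw [mk_toWord, ← mul_mk, ← mul_mk, ← inv_mk] at this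
  nth_rw 2 [← this]
  group

end Rotation

theorem IsCyclicallyReduced.classLength_mk {k : ℕ} {L : List (Fin k × Bool)}
    (h : IsCyclicallyReduced L) : classLength (ConjClasses.mk (mk L)) = L.length := by
  refine IsLeast.csInf_eq ⟨⟨mk L, rfl, by rw [toWord_mk, h.isReduced.reduce_eq]⟩, ?_⟩
  rintro n ⟨γ, hγ, rfl⟩
  have hr := (ConjClasses.mk_eq_mk_iff_isConj.1 hγ).reduceCyclically_isRotated
  rw [toWord_mk, h.isReduced.reduce_eq, h.reduceCyclically_eq] at hr
  rw [← hr.perm.length_eq]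
  exact length_reduceCyclically_le _

section Counting

variable {α : Type*}

/-- The inverse letter. -/
def letterInv (a : α × Bool) : α × Bool := (a.1, !a.2)

theorem ne_letterInv_iff {a b : α × Bool} : b ≠ letterInv a ↔ (a.1 = b.1 → a.2 = b.2) := by
  rcases a with ⟨a, s⟩
  rcases b with ⟨b, t⟩
  cases s <;> cases t <;> simp [letterInv, eq_comm]

theorem letterInv_letterInv (a : α × Bool) : letterInv (letterInv a) = a := by
  simp [letterInv]

theorem letterInv_involutive : Function.Involutive (letterInv (α := α)) := letterInv_letterInv

variable [Fintype α]

/-- The cyclically reduced words of length `n`. -/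
noncomputable def cyclicWords (α : Type*) [Fintype α] (n : ℕ) : Finset (List (α × Bool)) :=
  ((List.finite_length_eq (α × Bool) n).inter_of_left {L | IsCyclicallyReduced L}).toFinset

theorem mem_cyclicWords {n : ℕ} {L : List (α × Bool)} :
    L ∈ cyclicWords α n ↔ L.length = n ∧ IsCyclicallyReduced L := by
  simp [cyclicWords]

variable [DecidableEq α]

/-- The reduced words of length `n + 1` with first letter `x` and last letter `y`. -/
def reducedWords : ℕ → α × Bool → α × Bool → Finset (List (α × Bool))
  | 0, x, y => if x = y then {[x]} else ∅
  | n + 1, x, y => (Finset.univ.erase (letterInv x)).biUnion fun z ↦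
      (reducedWords n z y).image (List.cons x)

theorem mem_reducedWords {n : ℕ} {x y : α × Bool} {L : List (α × Bool)} :
    L ∈ reducedWords n x y ↔
      L.length = n + 1 ∧ L.head? = some x ∧ L.getLast? = some y ∧ IsReduced L := by
  induction n generalizing x L with
  | zero =>
    rw [reducedWords, zero_add, List.length_eq_one_iff]
    constructor
    · split_ifs with h
      · subst h
        simp +contextual
      · simp
    · rintro ⟨⟨a, rfl⟩, h1, h2, -⟩
      simp_all
  | succ n ih =>
    simp only [reducedWords, Finset.mem_biUnion, Finset.mem_image, Finset.mem_erase,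
      Finset.mem_univ, and_true, ih]
    constructor
    · rintro ⟨z, hz, M, ⟨h1, h2, h3, h4⟩, rfl⟩
      refine ⟨by simp [h1], by simp, by simp [List.getLast?_cons, h3], List.isChain_cons.2 ⟨?_, h4⟩⟩
      simpa [h2] using ne_letterInv_iff.1 hz
    · rintro ⟨h1, h2, h3, h4⟩
      match L, h1, h2, h3, h4 with
      | a :: b :: M, h1, h2, h3, h4 =>
        obtain rfl : a = x := by simpa using h2
        refine ⟨b, ne_letterInv_iff.2 (isReduced_cons_cons.1 h4).1, b :: M,
          ⟨by simpa using h1, by simp, by simpa [List.getLast?_cons] using h3,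
            (isReduced_cons_cons.1 h4).2⟩, rfl⟩

theorem card_reducedWords_succ (n : ℕ) (x y : α × Bool) :
    (reducedWords (n + 1) x y).card =
      ∑ z ∈ Finset.univ.erase (letterInv x), (reducedWords n z y).card := by
  rw [reducedWords, Finset.card_biUnion]
  · exact Finset.sum_congr rfl fun z _ ↦ Finset.card_image_of_injective _ (List.cons_injective)
  · intro z _ z' _ hzz'
    refine Finset.disjoint_left.2 fun L h h' ↦ hzz' ?_
    obtain ⟨M, hM, rfl⟩ := Finset.mem_image.1 h
    obtain ⟨M', hM', h⟩ := Finset.mem_image.1 h'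
    obtain rfl : M' = M := by simpa using h
    simpa [(mem_reducedWords.1 hM).2.1] using (mem_reducedWords.1 hM').2.1

theorem sum_card_reducedWords (n : ℕ) (y : α × Bool) :
    ∑ x, ((reducedWords n x y).card : ℝ) = (2 * (Fintype.card α : ℝ) - 1) ^ n := by
  induction n with
  | zero => simp [reducedWords, apply_ite Finset.card]
  | succ n ih =>
    have h : ∀ x : α × Bool, ((reducedWords (n + 1) x y).card : ℝ) =
        (2 * (Fintype.card α : ℝ) - 1) ^ n - (reducedWords n (letterInv x) y).card := fun x ↦ by
      rw [card_reducedWords_succ, Nat.cast_sum, ← ih, eq_sub_iff_add_eq,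
        Finset.sum_erase_add _ _ (Finset.mem_univ _)]
    simp_rw [h, Finset.sum_sub_distrib]
    rw [letterInv_involutive.bijective.sum_comp fun x ↦ ((reducedWords n x y).card : ℝ), ih]
    simp [Fintype.card_prod]
    ring

theorem cast_card_reducedWords_succ (n : ℕ) (x y : α × Bool) :
    ((reducedWords (n + 1) x y).card : ℝ) =
      (2 * (Fintype.card α : ℝ) - 1) ^ n - (reducedWords n (letterInv x) y).card := by
  rw [card_reducedWords_succ, Nat.cast_sum, ← sum_card_reducedWords n y, eq_sub_iff_add_eq,
    Finset.sum_erase_add _ _ (Finset.mem_univ _)]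

theorem abs_card_reducedWords_self_sub_le (n : ℕ) (x : α × Bool) :
    |2 * Fintype.card α * ((reducedWords n x x).card : ℝ) - (2 * (Fintype.card α : ℝ) - 1) ^ n| ≤
      2 * Fintype.card α := by
  have hpos : (1 : ℝ) ≤ Fintype.card α := by
    exact_mod_cast Fintype.card_pos_iff.2 ⟨x.1⟩
  induction n using Nat.twoStepInduction with
  | zero =>
    simp only [reducedWords, if_true, Finset.card_singleton, Nat.cast_one, mul_one, pow_zero]
    rw [abs_le]
    constructor <;> linarith
  | one =>
    rw [cast_card_reducedWords_succ, reducedWords, if_neg]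
    · simp
      linarith
    · simp [letterInv, Prod.ext_iff]
  | more n ih _ =>
    rw [cast_card_reducedWords_succ, cast_card_reducedWords_succ, letterInv_letterInv]
    convert ih using 2
    ring

theorem card_cyclicWords_succ (n : ℕ) :
    (cyclicWords α (n + 1)).card = ∑ y : α × Bool, (reducedWords (n + 1) y y).card := by
  have h : cyclicWords α (n + 1) = Finset.univ.biUnion fun y ↦
      (Finset.univ.erase (letterInv y)).biUnion fun x ↦ reducedWords n x y := by
    ext L
    simp only [mem_cyclicWords, Finset.mem_biUnion, Finset.mem_erase, Finset.mem_univ, and_true,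
      true_and, mem_reducedWords]
    constructor
    · rintro ⟨h1, h2, h3⟩
      have hL : L ≠ [] := by
        rintro rfl
        simp at h1
      refine ⟨L.getLast hL, L.head hL, ne_letterInv_iff.2 ?_, h1, List.head?_eq_some_head hL,
        List.getLast?_eq_some_getLast hL, h2⟩
      exact h3 _ (List.getLast?_eq_some_getLast hL) _ (List.head?_eq_some_head hL)
    · rintro ⟨y, x, hxy, h1, h2, h3, h4⟩
      refine ⟨h1, h4, ?_⟩
      simpa [h2, h3] using ne_letterInv_iff.1 hxy
  rw [h, Finset.card_biUnion]
  · refine Finset.sum_congr rfl fun y _ ↦ ?_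
    rw [card_reducedWords_succ, Finset.card_biUnion]
    intro x _ x' _ hxx'
    refine Finset.disjoint_left.2 fun L hL hL' ↦ hxx' ?_
    simpa [(mem_reducedWords.1 hL).2.1] using (mem_reducedWords.1 hL').2.1
  · intro y _ y' _ hyy'
    refine Finset.disjoint_left.2 fun L hL hL' ↦ hyy' ?_
    obtain ⟨x, -, hL⟩ := Finset.mem_biUnion.1 hL
    obtain ⟨x', -, hL'⟩ := Finset.mem_biUnion.1 hL'
    simpa [(mem_reducedWords.1 hL).2.2.1] using (mem_reducedWords.1 hL').2.2.1

theorem abs_card_cyclicWords_sub_le [Nonempty α] {n : ℕ} (hn : n ≠ 0) :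
    |((cyclicWords α n).card : ℝ) - (2 * (Fintype.card α : ℝ) - 1) ^ n| ≤
      2 * Fintype.card α := by
  obtain ⟨n, rfl⟩ := Nat.exists_eq_succ_of_ne_zero hn
  have hpos : (0 : ℝ) < 2 * Fintype.card α := by
    have : (0 : ℝ) < Fintype.card α := by exact_mod_cast Fintype.card_pos
    linarith
  have hcard : (Fintype.card (α × Bool) : ℝ) = 2 * Fintype.card α := by
    simp [Fintype.card_prod, mul_comm]
  have key := (Finset.abs_sum_le_sum_abs _ _).trans
    (Finset.sum_le_sum fun (x : α × Bool) (_ : x ∈ Finset.univ) ↦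
      abs_card_reducedWords_self_sub_le (n + 1) x)
  rw [Finset.sum_sub_distrib, ← Finset.mul_sum, Finset.sum_const, Finset.sum_const,
    Finset.card_univ, nsmul_eq_mul, nsmul_eq_mul, hcard, ← mul_sub, abs_mul, abs_of_pos hpos] at key
  rw [Nat.succ_eq_add_one, card_cyclicWords_succ, Nat.cast_sum]
  exact le_of_mul_le_mul_left key hpos

end Counting

section Rotations

variable {β : Type*}

theorem eq_of_rotate_eq_self_of_forall_getElem?_eq {L L' : List β} {j m : ℕ} (hj : 0 < j)
    (hjm : j ≤ m) (hlen : L.length = L'.length) (hL : L.rotate j = L) (hL' : L'.rotate j = L')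
    (h : ∀ i < m, L[i]? = L'[i]?) : L = L' := by
  refine List.ext_getElem? fun i ↦ ?_
  induction i using Nat.strong_induction_on with
  | _ i ih =>
    by_cases him : i < m
    · exact h i him
    by_cases hin : i < L.length
    · have key : ∀ M : List β, i < M.length → M.rotate j = M → M[i]? = M[i - j]? := fun M h hM ↦ by
        conv_rhs => rw [← hM]
        rw [List.getElem?_rotate (by omega), Nat.sub_add_cancel (by omega), Nat.mod_eq_of_lt h]
      rw [key L hin hL, key L' (hlen ▸ hin) hL']
      exact ih _ (by omega)
    · rw [List.getElem?_eq_none (by omega), List.getElem?_eq_none (by omega)]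

open Classical in
theorem card_filter_rotate_eq_self_le [Fintype β] [Nonempty β] {s : Finset (List β)} {n j m : ℕ}
    (hs : ∀ L ∈ s, L.length = n) (hj : 0 < j) (hjm : j ≤ m) (hmn : m ≤ n) :
    (s.filter fun L ↦ L.rotate j = L).card ≤ Fintype.card β ^ m := by
  let b : β := Classical.arbitrary β
  have hcard : Fintype.card β ^ m = (Finset.univ : Finset (Fin m → β)).card := by
    simp [Finset.card_univ]
  rw [hcard]
  refine Finset.card_le_card_of_injOn (fun L i ↦ L.getD i b) (by simp) fun L hL L' hL' h ↦ ?_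
  simp only [Finset.coe_filter, Set.mem_ofPred_eq] at hL hL'
  have h1 := hs L hL.1
  have h2 := hs L' hL'.1
  refine eq_of_rotate_eq_self_of_forall_getElem?_eq hj hjm (h1.trans h2.symm) hL.2 hL'.2
    fun i hi ↦ ?_
  have h3 := congr_fun h ⟨i, hi⟩
  have hi1 : i < L.length := by omega
  have hi2 : i < L'.length := by omega
  simpa [List.getD_eq_getElem?_getD, hi1, hi2] using h3

open Classical in
theorem card_filter_exists_rotate_eq_self_le [Fintype β] [Nonempty β] {s : Finset (List β)} {n : ℕ}
    (hs : ∀ L ∈ s, L.length = n) :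
    (s.filter fun L ↦ ∃ j, 0 < j ∧ j < n ∧ L.rotate j = L).card ≤
      n * Fintype.card β ^ (n / 2) := by
  have hsub : (s.filter fun L ↦ ∃ j, 0 < j ∧ j < n ∧ L.rotate j = L) ⊆
      (Finset.Icc 1 (n / 2)).biUnion fun j ↦ s.filter fun L ↦ L.rotate j = L := by
    intro L hL
    obtain ⟨hL, j, hj, hjn, h⟩ := Finset.mem_filter.1 hL
    simp only [Finset.mem_biUnion, Finset.mem_Icc, Finset.mem_filter]
    by_cases hj2 : j ≤ n / 2
    · exact ⟨j, ⟨hj, hj2⟩, hL, h⟩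
    · refine ⟨n - j, ⟨by omega, by omega⟩, hL, ?_⟩
      conv_lhs => rw [← h]
      rw [List.rotate_rotate, Nat.add_sub_cancel' hjn.le, ← hs L hL, List.rotate_length]
  refine (Finset.card_le_card hsub).trans (Finset.card_biUnion_le.trans ?_)
  refine (Finset.sum_le_card_nsmul _ _ (Fintype.card β ^ (n / 2)) fun j hj ↦ ?_).trans ?_
  · rw [Finset.mem_Icc] at hj
    exact card_filter_rotate_eq_self_le hs hj.1 hj.2 (Nat.div_le_self n 2)
  · rw [smul_eq_mul, Nat.card_Icc]
    gcongr
    omega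

end Rotations

section Classes

variable {k : ℕ}

theorem exists_isCyclicallyReduced_mk_eq (c : ConjClasses (FreeGroup (Fin k))) :
    ∃ L, IsCyclicallyReduced L ∧ ConjClasses.mk (mk L) = c := by
  obtain ⟨x, rfl⟩ := ConjClasses.exists_rep c
  obtain ⟨L, hL, h⟩ := exists_isCyclicallyReduced_isConj x
  exact ⟨L, hL, ConjClasses.mk_eq_mk_iff_isConj.2 h.symm⟩

open Classical in
/-- The conjugacy classes of cyclically reduced length `n`. -/
noncomputable def classesOfLength (k n : ℕ) : Finset (ConjClasses (FreeGroup (Fin k))) :=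
  (cyclicWords (Fin k) n).image fun L ↦ ConjClasses.mk (mk L)

theorem mem_classesOfLength {n : ℕ} {c : ConjClasses (FreeGroup (Fin k))} :
    c ∈ classesOfLength k n ↔ classLength c = n := by
  simp only [classesOfLength, Finset.mem_image, mem_cyclicWords]
  constructor
  · rintro ⟨L, ⟨rfl, hL⟩, rfl⟩
    exact hL.classLength_mk
  · rintro rfl
    obtain ⟨L, hL, rfl⟩ := exists_isCyclicallyReduced_mk_eq c
    exact ⟨L, ⟨hL.classLength_mk.symm, hL⟩, rfl⟩

theorem card_classLength_le (m : ℕ) :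
    Nat.card {c : ConjClasses (FreeGroup (Fin k)) // classLength c ≤ m} =
      ∑ n ∈ Finset.range (m + 1), (classesOfLength k n).card := by
  classical
  rw [← Finset.card_biUnion, ← Nat.card_eq_finsetCard]
  · refine Nat.card_congr (Equiv.subtypeEquivRight fun c ↦ ?_)
    simp [mem_classesOfLength]
  · intro i _ j _ hij
    refine Finset.disjoint_left.2 fun c hi hj ↦ hij ?_
    rw [← mem_classesOfLength.1 hi, ← mem_classesOfLength.1 hj]

theorem card_cyclicWords_le {n : ℕ} (hn : n ≠ 0) :
    (cyclicWords (Fin k) n).card ≤ n * (classesOfLength k n).card := by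
  classical
  refine Finset.card_le_mul_card_image _ _ fun c hc ↦ ?_
  obtain ⟨L, hL, rfl⟩ := Finset.mem_image.1 hc
  rw [mem_cyclicWords] at hL
  calc _ ≤ ((Finset.range n).image fun i ↦ L.rotate i).card := by
        refine Finset.card_le_card fun L' hL' ↦ ?_
        rw [Finset.mem_filter, mem_cyclicWords, ConjClasses.mk_eq_mk_iff_isConj] at hL'
        obtain ⟨i, rfl⟩ := hL.2.isRotated_of_isConj hL'.1.2 hL'.2.symm
        refine Finset.mem_image.2 ⟨i % n, Finset.mem_range.2 (Nat.mod_lt _ (by omega)), ?_⟩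
        rw [← hL.1, List.rotate_mod]
    _ ≤ n := Finset.card_image_le.trans (by simp)

theorem mul_card_classesOfLength_le (hk : k ≠ 0) (n : ℕ) :
    n * (classesOfLength k n).card ≤
      (cyclicWords (Fin k) n).card + n * (n * (2 * k) ^ (n / 2)) := by
  classical
  have : NeZero k := ⟨hk⟩
  let P : List (Fin k × Bool) → Prop := fun L ↦ ∃ j, 0 < j ∧ j < n ∧ L.rotate j = L
  let f : List (Fin k × Bool) → ConjClasses (FreeGroup (Fin k)) := fun L ↦ ConjClasses.mk (mk L)
  let s := cyclicWords (Fin k) n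
  have hP : (s.filter P).card ≤ n * (2 * k) ^ (n / 2) := by
    have := card_filter_exists_rotate_eq_self_le (s := s) (n := n)
      fun L hL ↦ (mem_cyclicWords.1 hL).1
    simpa [Fintype.card_prod, mul_comm k] using this
  have hnP : n * ((s.filter fun L ↦ ¬ P L).image f).card ≤ (s.filter fun L ↦ ¬ P L).card := by
    refine Finset.mul_card_image_le_card _ _ fun c hc ↦ ?_
    obtain ⟨L, hL, rfl⟩ := Finset.mem_image.1 hc
    obtain ⟨hLs, hLP⟩ := Finset.mem_filter.1 hL
    obtain ⟨hLn, hLc⟩ := mem_cyclicWords.1 hLs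
    have hcancel : ∀ i j, L.rotate (j + i) = L.rotate i → L.rotate j = L := fun i j h ↦ by
      rw [← List.rotate_rotate] at h
      exact List.rotate_injective i h
    have hinj : ∀ i j, i < j → j < n → L.rotate i ≠ L.rotate j := fun i j hij hj h ↦
      hLP ⟨j - i, by omega, by omega, hcancel i _ (by rw [Nat.sub_add_cancel hij.le, h])⟩
    have hcard : ((Finset.range n).image fun i ↦ L.rotate i).card = n := by
      rw [Finset.card_image_of_injOn, Finset.card_range]
      intro i hi j hj h
      rw [Finset.coe_range, Set.mem_Iio] at hi hj
      rcases lt_trichotomy i j with hij | hij | hij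
      · exact absurd h (hinj i j hij hj)
      · exact hij
      · exact absurd h.symm (hinj j i hij hi)
    conv_lhs => rw [← hcard]
    refine Finset.card_le_card fun L' hL' ↦ ?_
    obtain ⟨i, -, rfl⟩ := Finset.mem_image.1 hL'
    refine Finset.mem_filter.2 ⟨Finset.mem_filter.2
      ⟨mem_cyclicWords.2 ⟨by simpa using hLn, hLc.rotate i⟩, ?_⟩,
      (ConjClasses.mk_eq_mk_iff_isConj.2 (isConj_mk_rotate L i)).symm⟩
    rintro ⟨j, hj, hjn, h⟩
    rw [List.rotate_rotate, add_comm] at h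
    exact hLP ⟨j, hj, hjn, hcancel i j h⟩
  have hsplit : (classesOfLength k n).card ≤
      ((s.filter P).image f).card + ((s.filter fun L ↦ ¬ P L).image f).card := by
    have : classesOfLength k n = (s.filter P).image f ∪ (s.filter fun L ↦ ¬ P L).image f := by
      rw [← Finset.image_union, Finset.filter_union_filter_not_eq]
      rfl
    rw [this]
    exact Finset.card_union_le _ _
  calc n * (classesOfLength k n).card
      ≤ n * ((s.filter P).image f).card + n * ((s.filter fun L ↦ ¬ P L).image f).card := by
        rw [← mul_add]
        gcongr
    _ ≤ n * (n * (2 * k) ^ (n / 2)) + s.card := by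
        gcongr
        · exact Finset.card_image_le.trans hP
        · exact hnP.trans (Finset.card_filter_le _ _)
    _ = _ := add_comm _ _

end Classes

section Asymptotics

open Topology

theorem tendsto_sum_range_div_of_tendsto_mul_div_pow {C : ℕ → ℝ} {q : ℝ} (hq : 1 < q)
    (hC : Tendsto (fun n : ℕ ↦ n * C n / q ^ n) atTop (𝓝 1)) :
    Tendsto (fun m : ℕ ↦ (∑ n ∈ Finset.range (m + 1), C n) / (q / (q - 1) * q ^ m / m))
      atTop (𝓝 1) := by
  have hq0 : 0 < q := by linarith
  have hr0 : 0 ≤ q⁻¹ := by positivity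
  have hr1 : q⁻¹ < 1 := inv_lt_one_of_one_lt₀ hq
  have hr : |q⁻¹| < 1 := by rwa [abs_of_nonneg hr0]
  set u : ℕ → ℝ := fun n ↦ n * C n / q ^ n with hu
  obtain ⟨B, hB⟩ := (Metric.isBounded_range_of_tendsto u hC).exists_norm_le
  replace hB : ∀ n, |u n| ≤ B := fun n ↦ hB _ ⟨n, rfl⟩
  have hB0 : 0 ≤ B := (abs_nonneg _).trans (hB 0)
  let f : ℕ → ℕ → ℝ := fun m j ↦
    if j < m then u (m - j) * ((m : ℝ) / ((m - j : ℕ) : ℝ)) * q⁻¹ ^ j else 0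
  have hsum : Summable fun j : ℕ ↦ B * (((j : ℝ) + 1) * q⁻¹ ^ j) := by
    refine Summable.mul_left _ ?_
    simp_rw [add_mul, one_mul]
    refine Summable.add ?_ (summable_geometric_of_lt_one hr0 hr1)
    simpa using summable_pow_mul_geometric_of_norm_lt_one 1 (r := q⁻¹) hr
  have hlim : ∀ j, Tendsto (fun m ↦ f m j) atTop (𝓝 (q⁻¹ ^ j)) := fun j ↦ by
    have h1 : Tendsto (fun m : ℕ ↦ u (m - j)) atTop (𝓝 1) := hC.comp (tendsto_sub_atTop_nat j)
    have h2 : Tendsto (fun m : ℕ ↦ (m : ℝ) / ((m - j : ℕ) : ℝ)) atTop (𝓝 1) := by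
      rw [← tendsto_add_atTop_iff_nat j]
      have h3 : Tendsto (fun m : ℕ ↦ 1 + (j : ℝ) / (m : ℝ)) atTop (𝓝 (1 + 0)) :=
        (tendsto_const_div_atTop_nhds_zero_nat _).const_add _
      rw [add_zero] at h3
      refine h3.congr' ?_
      filter_upwards [eventually_gt_atTop 0] with m hm
      have : (m : ℝ) ≠ 0 := by positivity
      rw [Nat.add_sub_cancel]
      push_cast
      field_simp
    have h4 := (h1.mul h2).mul_const (q⁻¹ ^ j)
    rw [mul_one, one_mul] at h4
    refine h4.congr' ?_
    filter_upwards [eventually_gt_atTop j] with m hm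
    simp [f, hm]
  have hbound : ∀ m j, ‖f m j‖ ≤ B * (((j : ℝ) + 1) * q⁻¹ ^ j) := fun m j ↦ by
    by_cases hjm : j < m
    · have hpos : (0 : ℝ) < ((m - j : ℕ) : ℝ) := by
        exact_mod_cast Nat.sub_pos_of_lt hjm
      have h1 : (m : ℝ) / ((m - j : ℕ) : ℝ) ≤ j + 1 := by
        rw [div_le_iff₀ hpos]
        obtain ⟨d, rfl⟩ := Nat.exists_eq_add_of_lt hjm
        rw [show j + d + 1 - j = d + 1 by omega]
        exact_mod_cast (by nlinarith : j + d + 1 ≤ (j + 1) * (d + 1))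
      simp only [f, hjm, if_true]
      rw [norm_mul, norm_mul, Real.norm_of_nonneg (pow_nonneg hr0 j),
        Real.norm_of_nonneg (by positivity : 0 ≤ (m : ℝ) / ((m - j : ℕ) : ℝ)), mul_assoc]
      gcongr
      exact hB _
    · simp only [f, hjm, if_false, norm_zero]
      positivity
  have htsum := tendsto_tsum_of_dominated_convergence hsum hlim (Eventually.of_forall hbound)
  rw [tsum_geometric_of_lt_one hr0 hr1] at htsum
  have hzero : Tendsto (fun m : ℕ ↦ (m : ℝ) / q ^ m * C 0) atTop (𝓝 0) := by
    have := (tendsto_pow_const_mul_const_pow_of_abs_lt_one 1 hr).mul_const (C 0)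
    simpa [div_eq_mul_inv] using this
  have hfin := (hzero.add htsum).mul_const (1 - q⁻¹)
  rw [zero_add, inv_mul_cancel₀ (by linarith)] at hfin
  refine hfin.congr' ?_
  filter_upwards [eventually_gt_atTop 0] with m hm
  have hm' : (m : ℝ) ≠ 0 := by positivity
  have hf : ∑' j, f m j = m / q ^ m * ∑ n ∈ Finset.range m, C (n + 1) := by
    rw [tsum_eq_sum (s := Finset.range m) fun j hj ↦ if_neg (by simpa using hj),
      ← Finset.sum_range_reflect, Finset.mul_sum]
    refine Finset.sum_congr rfl fun i hi ↦ ?_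
    rw [Finset.mem_range] at hi
    obtain ⟨d, rfl⟩ := Nat.exists_eq_add_of_lt hi
    simp only [hu]
    rw [if_pos (by omega), show i + d + 1 - (i + d + 1 - 1 - i) = i + 1 by omega,
      show i + d + 1 - 1 - i = d by omega, pow_add, pow_add, pow_add]
    have : ((i + 1 : ℕ) : ℝ) ≠ 0 := by positivity
    rw [inv_pow]
    field_simp
  rw [hf, Finset.sum_range_succ']
  have : q - 1 ≠ 0 := by linarith
  field_simp
  ring

theorem tendsto_card_classesOfLength {k : ℕ} (hk : 2 ≤ k) :
    Tendsto (fun n : ℕ ↦ n * ((classesOfLength k n).card : ℝ) / (2 * (k : ℝ) - 1) ^ n)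
      atTop (𝓝 1) := by
  have hk' : (2 : ℝ) ≤ k := by exact_mod_cast hk
  have : NeZero k := ⟨by omega⟩
  set q : ℝ := 2 * (k : ℝ) - 1 with hq
  have hq3 : 3 ≤ q := by linarith
  have hA : ∀ n : ℕ, n ≠ 0 → |((cyclicWords (Fin k) n).card : ℝ) - q ^ n| ≤ 2 * k := fun n hn ↦ by
    simpa using abs_card_cyclicWords_sub_le (α := Fin k) hn
  have hpow : ∀ c : ℕ, ∀ r : ℝ, 0 ≤ r → r < q →
      Tendsto (fun n : ℕ ↦ (n : ℝ) ^ c * r ^ n / q ^ n) atTop (𝓝 0) := fun c r hr0 hr ↦ by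
    have h : |r / q| < 1 := by
      rw [abs_of_nonneg (by positivity), div_lt_one (by linarith)]
      exact hr
    refine (tendsto_pow_const_mul_const_pow_of_abs_lt_one c h).congr fun n ↦ ?_
    rw [div_pow, mul_div_assoc]
  have hconst : Tendsto (fun n : ℕ ↦ 2 * (k : ℝ) / q ^ n) atTop (𝓝 0) := by
    simpa [mul_div_assoc, div_eq_mul_inv] using
      (hpow 0 1 zero_le_one (by linarith)).const_mul (2 * (k : ℝ))
  have hsqrt : √(2 * k) < q := by
    rw [Real.sqrt_lt' (by linarith)]
    nlinarith
  have hsqrt1 : 1 ≤ √(2 * k) := Real.one_le_sqrt.2 (by linarith)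
  have herr := hpow 2 _ (Real.sqrt_nonneg _) hsqrt
  have hlower : Tendsto (fun n : ℕ ↦ 1 - 2 * (k : ℝ) / q ^ n) atTop (𝓝 1) := by
    simpa using hconst.const_sub 1
  have hupper : Tendsto (fun n : ℕ ↦ 1 + 2 * (k : ℝ) / q ^ n + (n : ℝ) ^ 2 * √(2 * k) ^ n / q ^ n)
      atTop (𝓝 1) := by
    simpa using (hconst.const_add 1).add herr
  refine tendsto_of_tendsto_of_tendsto_of_le_of_le' hlower hupper ?_ ?_
  · filter_upwards [eventually_ne_atTop 0] with n hn
    have h1 : ((cyclicWords (Fin k) n).card : ℝ) ≤ n * (classesOfLength k n).card := by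
      exact_mod_cast card_cyclicWords_le hn
    have h2 := (abs_le.1 (hA n hn)).1
    rw [le_div_iff₀ (by positivity), sub_mul, one_mul, div_mul_cancel₀ _ (by positivity)]
    linarith
  · filter_upwards [eventually_ne_atTop 0] with n hn
    have h1 : (n : ℝ) * (classesOfLength k n).card ≤
        (cyclicWords (Fin k) n).card + n * (n * (2 * k) ^ (n / 2)) := by
      exact_mod_cast mul_card_classesOfLength_le (by omega) n
    have h2 := (abs_le.1 (hA n hn)).2
    have h3 : (2 * (k : ℝ)) ^ (n / 2) ≤ √(2 * k) ^ n := by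
      calc (2 * (k : ℝ)) ^ (n / 2) = √(2 * k) ^ (2 * (n / 2)) := by
            rw [pow_mul, Real.sq_sqrt (by positivity)]
        _ ≤ √(2 * k) ^ n := pow_le_pow_right₀ hsqrt1 (Nat.mul_div_le n 2)
    have h4 : (n : ℝ) * (n * (2 * k) ^ (n / 2)) ≤ (n : ℝ) ^ 2 * √(2 * k) ^ n := by
      rw [← mul_assoc, ← sq]
      gcongr
    rw [div_le_iff₀ (by positivity), add_mul, add_mul, one_mul, div_mul_cancel₀ _ (by positivity),
      div_mul_cancel₀ _ (by positivity)]
    linarith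

end Asymptotics

end FreeGroup

theorem stmt_10 (k : ℕ) (hk : 2 ≤ k) :
    Tendsto (fun m : ℕ =>
        (Nat.card {c : ConjClasses (FreeGroup (Fin k)) // classLength c ≤ m} : ℝ) /
          ((2 * (k : ℝ) - 1) / ((2 * (k : ℝ) - 1) - 1) * (2 * (k : ℝ) - 1) ^ m / m))
      atTop (nhds 1) := by
  have hk' : (2 : ℝ) ≤ k := by exact_mod_cast hk
  have h := FreeGroup.tendsto_sum_range_div_of_tendsto_mul_div_pow (by linarith)
    (FreeGroup.tendsto_card_classesOfLength hk)
  simpa only [FreeGroup.card_classLength_le, Nat.cast_sum] using h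
end
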